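/- arXiv:2412.07124 — 2 statements merged into one kernel-verified Lean document; each statement's English description precedes it below -/
import Mathlib

section
/- Let α > 2 and let H : ℝ → ℝ be a smooth (C^∞) function with compact support. Then lim_{n→∞} sup_{x ∈ ℤ, 1 ≤ x ≤ n-1} | n² · Σ_{y ∈ ℤ, y ≠ x} |y - x|^{-1-α} (H(y/n) - H(x/n)) − c_α · H''(x/n) | = 0, where c_α = Σ_{y=1}^∞ y^{1-α} (a convergent series since α > 2). -/
/-- Second-order Taylor estimate for the symmetric second difference, in terms of the oscillation
of the second derivative. -/
theorem abs_second_difference_sub_le {H : ℝ → ℝ} (hH : Differentiable ℝ H)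
    (hH' : Differentiable ℝ (deriv H)) {u h M : ℝ} (hh : 0 ≤ h)
    (hM : ∀ v, |v - u| ≤ h → |deriv (deriv H) v - deriv (deriv H) u| ≤ M) :
    |H (u + h) + H (u - h) - 2 * H u - h ^ 2 * deriv (deriv H) u| ≤ 2 * M * h ^ 2 := by
  have hM0 : 0 ≤ M := (abs_nonneg _).trans (hM u (by simpa using hh))
  set D := deriv (deriv H) u with hD
  have slope : ∀ t ∈ Set.Icc 0 h,
      |deriv H (u + t) - deriv H (u - t) - 2 * t * D| ≤ 2 * M * h := by
    intro t ht
    have key := Convex.norm_image_sub_le_of_norm_hasDerivWithin_le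
      (f := fun w => deriv H w - w * D) (f' := fun w => deriv (deriv H) w - D)
      (s := Set.Icc (u - t) (u + t)) (C := M) (x := u - t) (y := u + t)
      (fun w _ => ((hH' w).hasDerivAt.sub (hasDerivAt_mul_const D)).hasDerivWithinAt)
      (fun w hw => hM w (abs_le.2 ⟨by linarith [hw.1, ht.2], by linarith [hw.2, ht.2]⟩))
      (convex_Icc _ _) ⟨le_rfl, by linarith [ht.1]⟩ ⟨by linarith [ht.1], le_rfl⟩
    rw [Real.norm_eq_abs, Real.norm_eq_abs,
      show u + t - (u - t) = 2 * t by ring, abs_of_nonneg (by linarith [ht.1] : 0 ≤ 2 * t)] at key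
    calc _ = |deriv H (u + t) - (u + t) * D - (deriv H (u - t) - (u - t) * D)| := by
          congr 1; ring
      _ ≤ M * (2 * t) := key
      _ ≤ 2 * M * h := by nlinarith [ht.2]
  have key := Convex.norm_image_sub_le_of_norm_hasDerivWithin_le
    (f := fun t => H (u + t) + H (u - t) - t ^ 2 * D)
    (f' := fun t => deriv H (u + t) - deriv H (u - t) - 2 * t * D)
    (s := Set.Icc 0 h) (C := 2 * M * h) (x := 0) (y := h)
    (fun t _ => by
      have h1 : HasDerivAt (fun t => H (u + t)) (deriv H (u + t)) t :=
        (hH _).hasDerivAt.comp_const_add u t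
      have h2 : HasDerivAt (fun t => H (u - t)) (-deriv H (u - t)) t :=
        (hH _).hasDerivAt.comp_const_sub u t
      have h3 : HasDerivAt (fun t : ℝ => t ^ 2 * D) (2 * t * D) t := by
        simpa using (hasDerivAt_pow 2 t).mul_const D
      exact ((h1.add h2).sub h3).hasDerivWithinAt)
    slope (convex_Icc _ _) ⟨le_rfl, hh⟩ ⟨hh, le_rfl⟩
  rw [Real.norm_eq_abs, Real.norm_eq_abs, sub_zero h, abs_of_nonneg hh] at key
  calc _ = |H (u + h) + H (u - h) - h ^ 2 * D - (H (u + 0) + H (u - 0) - 0 ^ 2 * D)| := by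
        congr 1; simp only [add_zero, sub_zero]; ring
    _ ≤ 2 * M * h * h := key
    _ = _ := by ring

theorem summable_nat_add_one_rpow {p : ℝ} (hp : p < -1) :
    Summable fun k : ℕ => ((k : ℝ) + 1) ^ p := by
  simpa using (summable_nat_add_iff 1).2 (Real.summable_nat_rpow.2 hp)

/-- The long-jump discrete Laplacian as a series of symmetric second differences. -/
theorem hasSum_long_jump_laplacian {p : ℝ} (hp : p < -1) {F : ℝ → ℝ} {B : ℝ}
    (hB : ∀ v, |F v| ≤ B) (n : ℝ) (x : ℤ) :
    HasSum (fun k : ℕ => ((k : ℝ) + 1) ^ p *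
        (F (x / n + ((k : ℝ) + 1) / n) + F (x / n - ((k : ℝ) + 1) / n) - 2 * F (x / n)))
      (∑' y : ℤ, if y = x then 0 else
        |(y : ℝ) - (x : ℝ)| ^ p * (F ((y : ℝ) / n) - F ((x : ℝ) / n))) := by
  have hs : ∀ g : ℕ → ℝ, Summable fun k : ℕ => ((k : ℝ) + 1) ^ p * (F (g k) - F (x / n)) := by
    intro g
    refine Summable.of_norm_bounded ((summable_nat_add_one_rpow hp).mul_right (2 * B)) fun k => ?_
    rw [norm_mul, Real.norm_of_nonneg (by positivity), Real.norm_eq_abs]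
    gcongr
    linarith [abs_sub (F (g k)) (F (x / n)), hB (g k), hB (x / n)]
  set f : ℤ → ℝ := fun y => if y = x then 0 else
    |(y : ℝ) - (x : ℝ)| ^ p * (F ((y : ℝ) / n) - F ((x : ℝ) / n)) with hf
  have hpos : ∀ k : ℕ, f ((k + 1 : ℤ) + x) =
      ((k : ℝ) + 1) ^ p * (F (x / n + ((k : ℝ) + 1) / n) - F (x / n)) := by
    intro k
    have hk : ((k + 1 : ℤ) + x) ≠ x := by omega
    simp only [hf, if_neg hk]
    push_cast
    rw [add_sub_cancel_right, abs_of_nonneg (by positivity), add_div _ (x : ℝ),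
      add_comm _ ((x : ℝ) / n)]
  have hneg : ∀ k : ℕ, f (-(k + 1 : ℤ) + x) =
      ((k : ℝ) + 1) ^ p * (F (x / n - ((k : ℝ) + 1) / n) - F (x / n)) := by
    intro k
    have hk : (-(k + 1 : ℤ) + x) ≠ x := by omega
    simp only [hf, if_neg hk]
    push_cast
    rw [add_sub_cancel_right, abs_neg, abs_of_nonneg (by positivity), add_div _ (x : ℝ), neg_div,
      neg_add_eq_sub]
  have h1 := (hs fun k => x / n + ((k : ℝ) + 1) / n).hasSum
  have h2 := (hs fun k => x / n - ((k : ℝ) + 1) / n).hasSum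
  have h3 : HasSum (fun z : ℤ => f (z + x)) _ :=
    HasSum.of_add_one_of_neg_add_one (by simpa only [hpos] using h1)
      (by simpa only [hneg] using h2)
  have h4 : f (0 + x) = 0 := by simp [hf]
  rw [← (Equiv.addRight x).tsum_eq f]
  simp only [Equiv.coe_addRight]
  rw [h3.tsum_eq, h4, add_zero]
  convert h1.add h2 using 2
  ring

/-- For `α > 2` and `H` smooth with compact support, the rescaled long-jump discrete
Laplacian converges, uniformly over lattice points `1 ≤ x ≤ n-1`, to `c_α · H''(x/n)`,
where `c_α = ∑_{y=1}^∞ y^{1-α}`. -/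
theorem stmt1 (α : ℝ) (hα : 2 < α) (H : ℝ → ℝ)
    (hH : ContDiff ℝ (⊤ : ℕ∞) H) (hsupp : HasCompactSupport H) :
    ∀ ε > 0, ∃ N : ℕ, ∀ n : ℕ, N ≤ n → ∀ x : ℤ, 1 ≤ x → x ≤ (n : ℤ) - 1 →
      |(n : ℝ) ^ 2 * (∑' y : ℤ, if y = x then 0 else
          |(y : ℝ) - (x : ℝ)| ^ (-1 - α) * (H ((y : ℝ) / n) - H ((x : ℝ) / n)))
        - (∑' y : ℕ, ((y : ℝ) + 1) ^ (1 - α)) * deriv (deriv H) ((x : ℝ) / n)| < ε := by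
  have hH1 : ContDiff ℝ (⊤ : ℕ∞) (deriv H) := (contDiff_infty_iff_deriv.1 hH).2
  have hH2 : ContDiff ℝ (⊤ : ℕ∞) (deriv (deriv H)) := (contDiff_infty_iff_deriv.1 hH1).2
  obtain ⟨B, hB⟩ := hH.continuous.bounded_above_of_compact_support hsupp
  obtain ⟨C, hC⟩ := hH2.continuous.bounded_above_of_compact_support hsupp.deriv.deriv
  obtain ⟨K, hK⟩ := hH2.lipschitzWith_of_hasCompactSupport hsupp.deriv.deriv (by simp)
  have hC0 : 0 ≤ C := (norm_nonneg _).trans (hC 0)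
  have hc := summable_nat_add_one_rpow (p := 1 - α) (by linarith)
  let E : ℕ → ℕ → ℝ := fun n k =>
    ((k : ℝ) + 1) ^ (1 - α) * (2 * min (2 * C) (K * (((k : ℝ) + 1) / n)))
  have hE0 : ∀ n k, 0 ≤ E n k := fun n k => by positivity
  have hEle : ∀ n k, ‖E n k‖ ≤ ((k : ℝ) + 1) ^ (1 - α) * (2 * (2 * C)) := fun n k => by
    rw [Real.norm_of_nonneg (hE0 n k)]
    have := min_le_left (2 * C) (K * (((k : ℝ) + 1) / n))
    dsimp only [E]
    gcongr
  have hlim : Filter.Tendsto (fun n => ∑' k, E n k) Filter.atTop (nhds 0) := by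
    have := tendsto_tsum_of_dominated_convergence (𝓕 := Filter.atTop) (f := E) (g := fun _ => 0)
      (hc.mul_right (2 * (2 * C))) (fun k => ?_) (Filter.Eventually.of_forall hEle)
    · simpa using this
    · have h1 : Filter.Tendsto (fun n : ℕ => (K : ℝ) * (((k : ℝ) + 1) / n)) Filter.atTop
          (nhds 0) := by
        simpa using (tendsto_const_div_atTop_nhds_zero_nat ((k : ℝ) + 1)).const_mul (K : ℝ)
      have h2 := (((tendsto_const_nhds (x := 2 * C)).min h1).const_mul 2).const_mul
        (((k : ℝ) + 1) ^ (1 - α))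
      simpa [E, hC0] using h2
  intro ε hε
  obtain ⟨N, hN⟩ := Filter.eventually_atTop.1 (hlim.eventually_lt_const hε)
  refine ⟨N, fun n hn x hx1 hx2 => lt_of_le_of_lt ?_ (hN n hn)⟩
  have hn0 : (0 : ℝ) < n := by
    have : 0 < n := by omega
    exact_mod_cast this
  have hsum := ((hasSum_long_jump_laplacian (p := -1 - α) (by linarith) hB (n : ℝ) x).mul_left
    ((n : ℝ) ^ 2)).sub (hc.hasSum.mul_right (deriv (deriv H) ((x : ℝ) / n)))
  rw [← hsum.tsum_eq, ← Real.norm_eq_abs]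
  refine tsum_of_norm_bounded
    (Summable.of_norm_bounded (hc.mul_right (2 * (2 * C))) (hEle n)).hasSum fun k => ?_
  set w : ℝ := (k : ℝ) + 1 with hw
  have hw0 : 0 < w := by positivity
  have hpow : w ^ (1 - α) = w ^ (-1 - α) * w ^ 2 := by
    rw [← Real.rpow_natCast, ← Real.rpow_add hw0]
    congr 1
    push_cast
    ring
  have hT := abs_second_difference_sub_le (hH.differentiable (by simp))
    (hH1.differentiable (by simp)) (u := (x : ℝ) / n) (h := w / n)
    (M := min (2 * C) (K * (w / n))) (by positivity) (fun v hv => by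
      refine le_min ?_ ?_
      · have h1 := hC v
        have h2 := hC (x / n)
        rw [Real.norm_eq_abs] at h1 h2
        linarith [abs_sub (deriv (deriv H) v) (deriv (deriv H) (x / n))]
      · have h1 := hK.dist_le_mul v (x / n)
        rw [Real.dist_eq, Real.dist_eq] at h1
        exact h1.trans (by gcongr))
  calc _ = |(n : ℝ) ^ 2 * w ^ (-1 - α) * (H (x / n + w / n) + H (x / n - w / n) - 2 * H (x / n)
            - (w / n) ^ 2 * deriv (deriv H) (x / n))| := by
        rw [Real.norm_eq_abs, hpow]
        congr 1
        field_simp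
    _ ≤ (n : ℝ) ^ 2 * w ^ (-1 - α) * (2 * min (2 * C) (K * (w / n)) * (w / n) ^ 2) := by
        rw [abs_mul, abs_of_nonneg (by positivity : 0 ≤ (n : ℝ) ^ 2 * w ^ (-1 - α))]
        gcongr
    _ = E n k := by
        simp only [E, ← hw]
        rw [hpow]
        field_simp
end

section
/- Let n ≥ 2 and K ≥ 1 be integers, γ > 1, and let H : [0,1] → ℝ be Lipschitz with constant L. Let Λ_n = {1,…,n-1}, let (η_x)_{x ∈ Λ_n} be i.i.d. Bernoulli(1/2) with η̄_x = η_x - 1/2, and let a_γ(x) = (p_γ(x) - p_γ(-x))/2 where p_γ(x) = x^{-1-γ} for integers x > 0 and p_γ(x) = 0 for x ≤ 0. Then there is a constant C = C(γ) > 0, independent of n, K, H, such that E[ ( Σ_{x,y ∈ Λ_n, |x-y| > K} a_γ(x-y) ( H(y/n) − H(x/n) ) η̄_x η̄_y )² ] ≤ C · L² / ( n · K^{2γ-1} ). -/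
/-- The value of a centred Bernoulli(1/2) variable at an outcome. -/
noncomputable def centredBit (b : Bool) : ℝ := (if b then 1 else 0) - 1 / 2

theorem centredBit_not (b : Bool) : centredBit (!b) = -centredBit b := by
  cases b <;> norm_num [centredBit]

theorem centredBit_mul_self (b : Bool) : centredBit b * centredBit b = 1 / 4 := by
  cases b <;> norm_num [centredBit]

/-- A coordinate that occurs exactly once in a product of four centred bits kills its sum. -/
theorem sum_centredBit_eq_zero {N : ℕ} {i j k l : Fin N} (hj : j ≠ i) (hk : k ≠ i)
    (hl : l ≠ i) :
    ∑ η : Fin N → Bool,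
      centredBit (η i) * centredBit (η j) * (centredBit (η k) * centredBit (η l)) = 0 := by
  have hinv : Function.Involutive
      (fun η : Fin N → Bool => Function.update η i (!η i)) := by
    intro η
    simp
  have h := Equiv.sum_comp hinv.toPerm (fun η : Fin N → Bool =>
    centredBit (η i) * centredBit (η j) * (centredBit (η k) * centredBit (η l)))
  simp only [Function.Involutive.coe_toPerm, Function.update_self,
    Function.update_of_ne hj, Function.update_of_ne hk, Function.update_of_ne hl,
    centredBit_not, neg_mul, Finset.sum_neg_distrib] at h
  linarith

/-- Products of centred bits over distinct unordered pairs are orthogonal. -/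
theorem expect_centredBit_pairs {N : ℕ} {i j k l : Fin N} (hij : i ≠ j) :
    ((1 : ℝ) / 2) ^ N * ∑ η : Fin N → Bool,
      centredBit (η i) * centredBit (η j) * (centredBit (η k) * centredBit (η l)) =
    (if k = i ∧ l = j then 1 / 16 else 0) + (if k = j ∧ l = i then 1 / 16 else 0) := by
  have hsq : ∀ η : Fin N → Bool,
      centredBit (η i) * centredBit (η j) * (centredBit (η i) * centredBit (η j)) = 1 / 16 := by
    intro η
    rw [mul_mul_mul_comm, centredBit_mul_self, centredBit_mul_self]
    norm_num
  have hconst : ((1 : ℝ) / 2) ^ N * ∑ _η : Fin N → Bool, (1 / 16 : ℝ) = 1 / 16 := by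
    simp
  by_cases h1 : k = i ∧ l = j
  · obtain ⟨rfl, rfl⟩ := h1
    simp only [hsq, hconst]
    simp [hij]
  by_cases h2 : k = j ∧ l = i
  · obtain ⟨rfl, rfl⟩ := h2
    rw [Finset.sum_congr rfl fun η _ => (by
      rw [← hsq η]
      ring : _ = (1 / 16 : ℝ)), hconst]
    simp [hij]
  rw [if_neg h1, if_neg h2, add_zero]
  by_cases hi : k ≠ i ∧ l ≠ i
  · rw [sum_centredBit_eq_zero hij.symm hi.1 hi.2, mul_zero]
  · have hj : k ≠ j ∧ l ≠ j := by
      constructor <;> rintro rfl <;> grind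
    rw [Finset.sum_congr rfl fun η _ => by rw [mul_comm (centredBit (η i))],
      sum_centredBit_eq_zero hij hj.1 hj.2, mul_zero]

/-- Second moment bound for an off-diagonal quadratic form in centred bits. -/
theorem expect_quadraticForm_sq_le {N : ℕ} (f : Fin N → Fin N → ℝ) (hf : ∀ i, f i i = 0) :
    ((1 : ℝ) / 2) ^ N * ∑ η : Fin N → Bool,
      (∑ i, ∑ j, f i j * (centredBit (η i) * centredBit (η j))) ^ 2 ≤
    1 / 8 * ∑ i, ∑ j, f i j ^ 2 := by
  have hterm : ∀ i j k l : Fin N,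
      ((1 : ℝ) / 2) ^ N * ∑ η : Fin N → Bool,
        f i j * (centredBit (η i) * centredBit (η j)) *
          (f k l * (centredBit (η k) * centredBit (η l))) =
      f i j * ((if k = i ∧ l = j then f k l / 16 else 0) +
        (if k = j ∧ l = i then f k l / 16 else 0)) := by
    intro i j k l
    by_cases hij : i = j
    · simp [hij, hf]
    have h := expect_centredBit_pairs (k := k) (l := l) hij
    have h' : ∑ η : Fin N → Bool, f i j * (centredBit (η i) * centredBit (η j)) *
          (f k l * (centredBit (η k) * centredBit (η l))) = f i j * f k l *
        ∑ η : Fin N → Bool,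
      centredBit (η i) * centredBit (η j) * (centredBit (η k) * centredBit (η l)) := by
      rw [Finset.mul_sum]
      exact Finset.sum_congr rfl fun η _ => by ring
    rw [h', mul_left_comm, h]
    split_ifs <;> ring
  have hexp : ((1 : ℝ) / 2) ^ N * ∑ η : Fin N → Bool,
      (∑ i, ∑ j, f i j * (centredBit (η i) * centredBit (η j))) ^ 2 =
      ∑ i, ∑ j, f i j * (f i j / 16 + f j i / 16) := by
    calc _ = ∑ i, ∑ j, ∑ k, ∑ l, ((1 : ℝ) / 2) ^ N * ∑ η : Fin N → Bool,
        f i j * (centredBit (η i) * centredBit (η j)) *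
          (f k l * (centredBit (η k) * centredBit (η l))) := by
          simp_rw [sq, Finset.sum_mul, Finset.mul_sum]
          rw [Finset.sum_comm]
          refine Finset.sum_congr rfl fun i _ => ?_
          rw [Finset.sum_comm]
          refine Finset.sum_congr rfl fun j _ => ?_
          rw [Finset.sum_comm]
          refine Finset.sum_congr rfl fun k _ => ?_
          rw [Finset.sum_comm]
      _ = _ := by
          refine Finset.sum_congr rfl fun i _ => Finset.sum_congr rfl fun j _ => ?_
          simp_rw [hterm, ← Finset.mul_sum, Finset.sum_add_distrib, ite_and]
          simp
  rw [hexp]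
  have hswap : ∑ i, ∑ j, f j i ^ 2 = ∑ i, ∑ j, f i j ^ 2 := Finset.sum_comm
  calc _ ≤ ∑ i, ∑ j, (1 / 16 * f i j ^ 2 + 1 / 32 * (f i j ^ 2 + f j i ^ 2)) :=
        Finset.sum_le_sum fun i _ => Finset.sum_le_sum fun j _ => by
          nlinarith [sq_nonneg (f i j - f j i)]
    _ = _ := by
        simp_rw [Finset.sum_add_distrib, ← Finset.mul_sum, Finset.sum_add_distrib, hswap]
        ring

/-- Integral comparison for the tail of a convergent power series. -/
theorem sum_Ioc_rpow_neg_le {s : ℝ} (hs : 1 < s) {K : ℕ} (hK : 1 ≤ K) (M : ℕ) :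
    ∑ z ∈ Finset.Ioc K M, (z : ℝ) ^ (-s) ≤ (K : ℝ) ^ (1 - s) / (s - 1) := by
  have hK0 : (0 : ℝ) < K := by exact_mod_cast hK
  have hs' : 0 < s - 1 := by linarith
  rcases le_or_gt M K with h | h
  · rw [Finset.Ioc_eq_empty_of_le h, Finset.sum_empty]
    positivity
  have hM0 : (0 : ℝ) < M := by exact_mod_cast (by omega : 0 < M)
  have hanti : AntitoneOn (fun x : ℝ => x ^ (-s)) (Set.Icc (K : ℝ) M) := by
    intro x hx y _ hxy
    exact Real.rpow_le_rpow_of_nonpos (hK0.trans_le hx.1) hxy (by linarith)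
  have hint := hanti.sum_le_integral_Ico h.le
  rw [integral_rpow (Or.inr ⟨by linarith, by
    rw [Set.uIcc_of_le (by exact_mod_cast h.le)]
    exact fun h0 => absurd h0.1 (not_le.mpr hK0)⟩)] at hint
  have hshift : ∑ z ∈ Finset.Ioc K M, (z : ℝ) ^ (-s) =
      ∑ z ∈ Finset.Ico K M, ((z + 1 : ℕ) : ℝ) ^ (-s) := by
    rw [Finset.sum_Ico_add' (fun z : ℕ => (z : ℝ) ^ (-s))]
    refine Finset.sum_congr ?_ fun _ _ => rfl
    ext z
    simp only [Finset.mem_Ioc, Finset.mem_Ico]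
    omega
  rw [hshift]
  refine hint.trans ?_
  have hMpos := Real.rpow_nonneg hM0.le (1 - s)
  rw [show -s + 1 = 1 - s by ring, ← neg_div_neg_eq]
  rw [show -(1 - s) = s - 1 by ring]
  gcongr
  linarith

/-- Each distance from a fixed site is attained at most twice. -/
theorem sum_far_sites_le {N K : ℕ} (i : Fin N) {g : ℕ → ℝ} (hg : ∀ z, 0 ≤ g z) :
    ∑ j : Fin N, (if K < ((i : ℤ) - j).natAbs then g ((i : ℤ) - j).natAbs else 0) ≤
      2 * ∑ z ∈ Finset.Ioc K N, g z := by
  rw [← Finset.sum_filter, ← Finset.sum_fiberwise_of_maps_to (t := Finset.Ioc K N)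
    (g := fun j : Fin N => ((i : ℤ) - j).natAbs), Finset.mul_sum]
  · refine Finset.sum_le_sum fun z _ => ?_
    rw [Finset.sum_congr rfl fun j hj => by rw [(Finset.mem_filter.mp hj).2],
      Finset.sum_const, nsmul_eq_mul]
    refine mul_le_mul_of_nonneg_right ?_ (hg z)
    have hcard := Finset.card_le_card_of_injOn
      (s := (Finset.univ.filter fun j : Fin N => K < ((i : ℤ) - j).natAbs).filter
        fun j : Fin N => ((i : ℤ) - j).natAbs = z)
      (t := ({(i : ℤ) - z, (i : ℤ) + z} : Finset ℤ)) (fun j : Fin N => (j : ℤ))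
      (fun j hj => by
        rw [Finset.mem_coe, Finset.mem_filter] at hj
        simp only [Finset.coe_insert, Finset.coe_singleton, Set.mem_insert_iff,
          Set.mem_singleton_iff]
        omega)
      (fun j _ k _ h =>
        Fin.ext (Int.ofNat_inj.mp h))
    calc _ ≤ ((2 : ℕ) : ℝ) := Nat.cast_le.mpr (hcard.trans Finset.card_le_two)
      _ = 2 := Nat.cast_ofNat
  · intro j hj
    have := (Finset.mem_filter.mp hj).2
    have := i.isLt
    have := j.isLt
    rw [Finset.mem_Ioc]
    omega

/-- The antisymmetric part of the one-sided kernel `z ^ (-1 - γ)`, squared. -/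
theorem antisymm_kernel_sq {γ : ℝ} (z : ℤ) (hz : z ≠ 0) :
    (((if 0 < z then (z : ℝ) ^ (-1 - γ) else 0) -
      (if 0 < -z then ((-z : ℤ) : ℝ) ^ (-1 - γ) else 0)) / 2) ^ 2 =
    1 / 4 * (((z.natAbs : ℝ) ^ (-1 - γ)) ^ 2) := by
  have habs : (z.natAbs : ℝ) = |(z : ℝ)| := by
    rw [Nat.cast_natAbs, Int.cast_abs]
  rw [habs]
  rcases lt_or_gt_of_ne hz with h | h
  · have hR : (z : ℝ) < 0 := by exact_mod_cast h
    rw [if_neg (by omega), if_pos (by omega), abs_of_neg hR]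
    push_cast
    ring
  · have hR : (0 : ℝ) < z := by exact_mod_cast h
    rw [if_pos h, if_neg (by omega), abs_of_pos hR]
    ring


/-- Static second-moment cut-off estimate: for `γ > 1` there is `C = C(γ) > 0` such that
for all integers `n ≥ 2`, `K ≥ 1` and every `H` Lipschitz on `[0,1]` with constant `L`,
`E[(∑_{|x-y| > K} a_γ(x-y)(H(y/n)-H(x/n)) η̄_x η̄_y)²] ≤ C L² / (n K^{2γ-1})`,
the expectation being over i.i.d. Bernoulli(1/2) variables indexed by `Λ_n = {1,…,n-1}`
(site `i + 1` for `i : Fin (n-1)`). -/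
theorem stmt16 (γ : ℝ) (hγ : 1 < γ) :
    ∃ C > 0, ∀ n K : ℕ, 2 ≤ n → 1 ≤ K →
      ∀ (L : NNReal) (H : ℝ → ℝ), LipschitzOnWith L H (Set.Icc 0 1) →
      (let p : ℤ → ℝ := fun z => if 0 < z then (z : ℝ) ^ (-1 - γ) else 0
       let a : ℤ → ℝ := fun z => (p z - p (-z)) / 2
       let bar : Bool → ℝ := fun b => (if b then 1 else 0) - 1/2
       ((1:ℝ)/2) ^ (n - 1) * ∑ η : Fin (n - 1) → Bool,
         (∑ i : Fin (n - 1), ∑ j : Fin (n - 1),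
            if (K : ℤ) < |(i.val : ℤ) - (j.val : ℤ)| then
              a ((i.val : ℤ) - (j.val : ℤ)) *
                (H (((j.val : ℝ) + 1) / n) - H (((i.val : ℝ) + 1) / n)) *
                bar (η i) * bar (η j)
            else 0) ^ 2)
      ≤ C * (L : ℝ) ^ 2 / ((n : ℝ) * (K : ℝ) ^ (2 * γ - 1)) := by
  refine ⟨1 / (16 * (2 * γ - 1)), by apply one_div_pos.mpr; linarith, ?_⟩
  intro n K hn hK L H hH
  extract_lets p a bar
  have hn0 : (0 : ℝ) < n := by exact_mod_cast (by omega : 0 < n)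
  have hK0 : (0 : ℝ) < K := by exact_mod_cast hK
  set f : Fin (n - 1) → Fin (n - 1) → ℝ := fun i j =>
    if (K : ℤ) < |(i.val : ℤ) - (j.val : ℤ)| then
      a ((i.val : ℤ) - (j.val : ℤ)) *
        (H (((j.val : ℝ) + 1) / n) - H (((i.val : ℝ) + 1) / n))
    else 0 with hf
  have hdiag : ∀ i, f i i = 0 := fun i => by simp [hf]
  have hmem : ∀ i : Fin (n - 1), ((i.val : ℝ) + 1) / n ∈ Set.Icc (0 : ℝ) 1 := by
    intro i
    refine ⟨by positivity, (div_le_one hn0).mpr ?_⟩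
    have := i.isLt
    exact_mod_cast (by omega : i.val + 1 ≤ n)
  have hfsq : ∀ i j, f i j ^ 2 ≤ (L : ℝ) ^ 2 / (4 * (n : ℝ) ^ 2) *
      (if K < ((i : ℤ) - j).natAbs then
        ((((i : ℤ) - j).natAbs : ℕ) : ℝ) ^ (-(2 * γ)) else 0) := by
    intro i j
    by_cases h : (K : ℤ) < |(i.val : ℤ) - (j.val : ℤ)|
    · have hnat : K < ((i : ℤ) - j).natAbs := by
        rw [Int.abs_eq_natAbs] at h
        omega
      have hz : (i.val : ℤ) - (j.val : ℤ) ≠ 0 := by omega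
      simp only [hf, if_pos h, if_pos hnat, mul_pow]
      have ha : a ((i.val : ℤ) - (j.val : ℤ)) ^ 2 = _ := antisymm_kernel_sq _ hz
      rw [ha]
      set w : ℝ := ((((i : ℤ) - j).natAbs : ℕ) : ℝ) with hw
      have hw0 : 0 < w := by
        rw [hw]
        exact_mod_cast (by omega : 0 < ((i : ℤ) - j).natAbs)
      have hLip : |H (((j.val : ℝ) + 1) / n) - H (((i.val : ℝ) + 1) / n)| ≤ L * (w / n) := by
        have hd := hH.dist_le_mul _ (hmem j) _ (hmem i)
        rw [Real.dist_eq, Real.dist_eq] at hd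
        refine hd.trans_eq ?_
        rw [← sub_div, abs_div, abs_of_pos hn0, hw, Nat.cast_natAbs, Int.cast_abs, abs_sub_comm]
        push_cast
        congr 3
        ring
      have hH2 : (H (((j.val : ℝ) + 1) / n) - H (((i.val : ℝ) + 1) / n)) ^ 2 ≤
          (L * (w / n)) ^ 2 := by
        rw [← sq_abs]
        gcongr
      have hpow : (w ^ (-1 - γ)) ^ 2 * w ^ 2 = w ^ (-(2 * γ)) := by
        rw [← mul_pow, ← Real.rpow_add_one hw0.ne', ← Real.rpow_natCast, ← Real.rpow_mul hw0.le]
        congr 1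
        push_cast
        ring
      calc _ ≤ 1 / 4 * (w ^ (-1 - γ)) ^ 2 * (L * (w / n)) ^ 2 := by gcongr
        _ = (L : ℝ) ^ 2 / (4 * (n : ℝ) ^ 2) * ((w ^ (-1 - γ)) ^ 2 * w ^ 2) := by
            field_simp
        _ = _ := by rw [hpow]
    · simp only [hf, if_neg h]
      have hnat : ¬ K < ((i : ℤ) - j).natAbs := by
        rw [Int.abs_eq_natAbs] at h
        omega
      simp [hnat]
  have hrow : ∀ i, ∑ j, f i j ^ 2 ≤ (L : ℝ) ^ 2 / (4 * (n : ℝ) ^ 2) *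
      (2 * ((K : ℝ) ^ (1 - 2 * γ) / (2 * γ - 1))) := by
    intro i
    refine (Finset.sum_le_sum fun j _ => hfsq i j).trans ?_
    rw [← Finset.mul_sum]
    gcongr
    refine (sum_far_sites_le i (g := fun z => (z : ℝ) ^ (-(2 * γ)))
      fun z => by positivity).trans ?_
    gcongr
    exact sum_Ioc_rpow_neg_le (by linarith) hK _
  have hγ' : 0 < 2 * γ - 1 := by linarith
  have hquad := expect_quadraticForm_sq_le f hdiag
  have hcongr : ∀ (η : Fin (n - 1) → Bool) (i j : Fin (n - 1)),
      (if (K : ℤ) < |(i.val : ℤ) - (j.val : ℤ)| then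
        a ((i.val : ℤ) - (j.val : ℤ)) *
          (H (((j.val : ℝ) + 1) / n) - H (((i.val : ℝ) + 1) / n)) *
          bar (η i) * bar (η j)
      else 0) = f i j * (centredBit (η i) * centredBit (η j)) := by
    intro η i j
    simp only [hf, ite_mul, zero_mul, mul_assoc]
    rfl
  simp only [hcongr]
  calc _ ≤ 1 / 8 * ∑ i, ∑ j, f i j ^ 2 := hquad
    _ ≤ 1 / 8 * ∑ _i : Fin (n - 1), (L : ℝ) ^ 2 / (4 * (n : ℝ) ^ 2) *
        (2 * ((K : ℝ) ^ (1 - 2 * γ) / (2 * γ - 1))) := by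
        gcongr with i _
        exact hrow i
    _ = 1 / 8 * (((n - 1 : ℕ) : ℝ) * ((L : ℝ) ^ 2 / (4 * (n : ℝ) ^ 2) *
        (2 * ((K : ℝ) ^ (1 - 2 * γ) / (2 * γ - 1))))) := by
        rw [Finset.sum_const, Finset.card_univ, Fintype.card_fin, nsmul_eq_mul]
    _ ≤ 1 / 8 * ((n : ℝ) * ((L : ℝ) ^ 2 / (4 * (n : ℝ) ^ 2) *
        (2 * ((K : ℝ) ^ (1 - 2 * γ) / (2 * γ - 1))))) := by
        gcongr
        omega
    _ = _ := by
        rw [show 1 - 2 * γ = -(2 * γ - 1) by ring, Real.rpow_neg hK0.le]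
        field_simp
        ring
end
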